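/- Let β be a non-increasing weight sequence, X, U, Y complex Hilbert spaces, T ∈ L(X), E ∈ L(X,Y), N ∈ L(X,U), with (E,T) β-output stable and (N,T) 1-output stable. Then there exists an analytic S : 𝔻 → L(U,Y) which is a contractive multiplier from H²(U) to H²_β(Y) and satisfies the interpolation condition (E*S)^{∧L}(T*) = N* if and only if for every x ∈ X: Σ_{j≥0} β_j^{-1} ‖E T^j x‖² ≥ Σ_{j≥0} ‖N T^j x‖². -/

import Mathlib

open Metric Filter

noncomputable section

/-- `β` is a weight sequence: positive, `β 0 = 1`, and `liminf β_j^(1/j) ≥ 1`. -/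
def IsWeightSeq (β : ℕ → ℝ) : Prop :=
  (∀ j, 0 < β j) ∧ β 0 = 1 ∧
    1 ≤ Filter.liminf (fun j : ℕ => β j ^ ((1 : ℝ) / j)) Filter.atTop

/-- The pair `(E,T)` is `β`-output stable. -/
def OutputStable {X Y : Type*} [NormedAddCommGroup X] [InnerProductSpace ℂ X]
    [NormedAddCommGroup Y] [InnerProductSpace ℂ Y]
    (β : ℕ → ℝ) (E : X →L[ℂ] Y) (T : X →L[ℂ] X) : Prop :=
  ∃ C : ℝ, 0 ≤ C ∧ ∀ x : X,
    Summable (fun j => (β j)⁻¹ * ‖E ((T ^ j) x)‖ ^ 2) ∧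
    ∑' j, (β j)⁻¹ * ‖E ((T ^ j) x)‖ ^ 2 ≤ C * ‖x‖ ^ 2

/-- `S`, with Taylor coefficients `Sc`, is a contractive multiplier from `H²(U)` to
`H²_β(Y)`. -/
def IsContractiveMultiplier {U Y : Type*} [NormedAddCommGroup U] [InnerProductSpace ℂ U]
    [NormedAddCommGroup Y] [InnerProductSpace ℂ Y]
    (β : ℕ → ℝ) (Sc : ℕ → (U →L[ℂ] Y)) : Prop :=
  ∀ h : ℕ → U, Summable (fun k => ‖h k‖ ^ 2) →
    Summable (fun ℓ => β ℓ * ‖∑ j ∈ Finset.range (ℓ + 1), Sc j (h (ℓ - j))‖ ^ 2) ∧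
    ∑' ℓ, β ℓ * ‖∑ j ∈ Finset.range (ℓ + 1), Sc j (h (ℓ - j))‖ ^ 2 ≤ ∑' k, ‖h k‖ ^ 2

/-- Douglas' factorization lemma for contractions. -/
lemma exists_contraction_comp_eq {X H K : Type*}
    [NormedAddCommGroup X] [InnerProductSpace ℂ X]
    [NormedAddCommGroup H] [InnerProductSpace ℂ H] [CompleteSpace H]
    [NormedAddCommGroup K] [InnerProductSpace ℂ K] [CompleteSpace K]
    (A : X →L[ℂ] H) (B : X →L[ℂ] K) (h : ∀ x, ‖B x‖ ≤ ‖A x‖) :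
    ∃ W : H →L[ℂ] K, ‖W‖ ≤ 1 ∧ ∀ x, W (A x) = B x := by
  let M : Submodule ℂ H := (LinearMap.range A.toLinearMap).topologicalClosure
  have hM : IsClosed (M : Set H) := Submodule.isClosed_topologicalClosure _
  have : CompleteSpace M := hM.completeSpace_coe
  have hAM : ∀ x, A.toLinearMap x ∈ M := fun x =>
    Submodule.le_topologicalClosure _ (LinearMap.mem_range_self _ x)
  let e : X →ₗ[ℂ] M := A.toLinearMap.codRestrict M hAM
  have he : DenseRange e := by
    intro y
    rw [Metric.mem_closure_iff]
    intro ε hε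
    obtain ⟨_, ⟨x, rfl⟩, hx⟩ := Metric.mem_closure_iff.1 (show (y : H) ∈ closure _ from y.2) ε hε
    exact ⟨e x, ⟨x, rfl⟩, hx⟩
  have hn : ∀ x, ‖B.toLinearMap x‖ ≤ 1 * ‖e x‖ := fun x => by simpa [e] using h x
  let W₀ : M →L[ℂ] K := B.toLinearMap.extendOfNorm e
  refine ⟨W₀ ∘L M.orthogonalProjectionOnto, ?_, fun x => ?_⟩
  · refine (W₀.opNorm_comp_le _).trans ?_
    exact mul_le_one₀ (LinearMap.opNorm_extendOfNorm_le he zero_le_one hn) (norm_nonneg _)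
      (M.orthogonalProjectionOnto_norm_le)
  · have : M.orthogonalProjectionOnto (A x) = e x :=
      Submodule.orthogonalProjectionOnto_mem_subspace_eq_self (K := M) (e x)
    simp only [ContinuousLinearMap.comp_apply, this]
    exact LinearMap.extendOfNorm_eq he ⟨1, hn⟩ x

lemma lp_two_hasSum_norm_sq {ι F : Type*} [NormedAddCommGroup F] (f : lp (fun _ : ι => F) 2) :
    HasSum (fun i => ‖f i‖ ^ 2) (‖f‖ ^ 2) := by
  have := lp.hasSum_norm (p := 2) (by simp) f
  simpa using this

/-- A square-summable uniformly bounded family of operators assembles into an operator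
into `ℓ²`. -/
lemma exists_clm_lp_two {X F : Type*} [NormedAddCommGroup X] [InnerProductSpace ℂ X]
    [NormedAddCommGroup F] [InnerProductSpace ℂ F] (L : ℕ → X →L[ℂ] F) (C : ℝ)
    (hs : ∀ x, Summable fun j => ‖L j x‖ ^ 2) (hC : ∀ x, ∑' j, ‖L j x‖ ^ 2 ≤ C * ‖x‖ ^ 2) :
    ∃ O : X →L[ℂ] lp (fun _ : ℕ => F) 2, ∀ x j, O x j = L j x := by
  have hm : ∀ x, Memℓp (fun j => L j x) 2 := fun x => memℓp_gen (by simpa using hs x)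
  let O : X →ₗ[ℂ] lp (fun _ : ℕ => F) 2 :=
    { toFun := fun x => ⟨fun j => L j x, hm x⟩
      map_add' := fun x y => by ext j; exact map_add (L j) x y
      map_smul' := fun c x => by ext j; simp }
  refine ⟨O.mkContinuous (Real.sqrt C) fun x => ?_, fun x j => rfl⟩
  have h1 : ‖O x‖ ^ 2 ≤ C * ‖x‖ ^ 2 := by
    rw [← (lp_two_hasSum_norm_sq (O x)).tsum_eq]
    exact hC x
  have h2 := Real.sqrt_le_sqrt h1
  rwa [Real.sqrt_sq (norm_nonneg _), Real.sqrt_mul' _ (sq_nonneg _),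
    Real.sqrt_sq (norm_nonneg _)] at h2

/-- A nonnegative difference `A† A - B† B` has a square root. -/
lemma exists_sqrt_sub {X H K : Type*}
    [NormedAddCommGroup X] [InnerProductSpace ℂ X] [CompleteSpace X]
    [NormedAddCommGroup H] [InnerProductSpace ℂ H] [CompleteSpace H]
    [NormedAddCommGroup K] [InnerProductSpace ℂ K] [CompleteSpace K]
    (A : X →L[ℂ] H) (B : X →L[ℂ] K) (h : ∀ x, ‖B x‖ ≤ ‖A x‖) :
    ∃ R : X →L[ℂ] X, ∀ x, ‖R x‖ ^ 2 = ‖A x‖ ^ 2 - ‖B x‖ ^ 2 := by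
  obtain ⟨W, hW, hWA⟩ := exists_contraction_comp_eq A B h
  let P : X →L[ℂ] X := A.adjoint ∘L A - B.adjoint ∘L B
  have hP : ∀ x, inner ℂ (P x) x = ((‖A x‖ ^ 2 - ‖B x‖ ^ 2 : ℝ) : ℂ) := fun x => by
    simp [P, ContinuousLinearMap.adjoint_inner_left]
  have hpos : 0 ≤ P := by
    rw [ContinuousLinearMap.nonneg_iff_isPositive, ContinuousLinearMap.isPositive_iff_complex]
    intro x
    rw [hP]
    refine ⟨by simp [-Complex.ofReal_sub], ?_⟩
    simp only [RCLike.re_to_complex, Complex.ofReal_re]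
    have := h x
    have := norm_nonneg (B x)
    nlinarith
  have hsa : IsSelfAdjoint (CFC.sqrt P) := IsSelfAdjoint.of_nonneg (CFC.sqrt_nonneg P)
  refine ⟨CFC.sqrt P, fun x => ?_⟩
  have h1 : inner ℂ (CFC.sqrt P x) (CFC.sqrt P x) = inner ℂ (P x) x := by
    conv_rhs => rw [← CFC.sqrt_mul_sqrt_self P hpos]
    rw [mul_apply_eq_comp, ← ContinuousLinearMap.adjoint_inner_left,
      hsa.adjoint_eq]
  rw [hP, inner_self_eq_norm_sq_to_K] at h1
  rw [← RCLike.ofReal_pow] at h1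
  exact RCLike.ofReal_injective (K := ℂ) h1

section

open Finset.HasAntidiagonal

lemma HasSum.of_forall_eq {ι α : Type*} [AddCommMonoid α] [TopologicalSpace α] {f g : ι → α}
    {a : α} (hf : HasSum f a) (h : ∀ i, g i = f i) : HasSum g a := by
  rwa [funext h]

lemma HasSum.sum_antidiagonal {α : Type*} [NormedAddCommGroup α] {f : ℕ × ℕ → α} {s : α}
    (hf : HasSum f s) : HasSum (fun m => ∑ p ∈ antidiagonal m, f p) s := by
  have h := (sigmaAntidiagonalEquivProd (A := ℕ)).hasSum_iff.2 hf
  convert h.sigma fun m => hasSum_fintype _ using 2 with m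
  exact (Finset.sum_coe_sort (antidiagonal m) f).symm

lemma hasSum_of_hasSum_antidiagonal {f : ℕ × ℕ → ℝ} {s : ℝ} (hf₀ : ∀ p, 0 ≤ f p)
    (hf : HasSum (fun m => ∑ p ∈ antidiagonal m, f p) s) : HasSum f s := by
  have hs : Summable f := by
    rw [← (sigmaAntidiagonalEquivProd (A := ℕ)).summable_iff,
      Function.comp_def,
      summable_sigma_of_nonneg fun x => hf₀ (sigmaAntidiagonalEquivProd x)]
    refine ⟨fun n => (hasSum_fintype _).summable, ?_⟩
    convert hf.summable using 2 with m
    rw [tsum_fintype]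
    exact Finset.sum_coe_sort (antidiagonal m) f
  exact hs.hasSum.sum_antidiagonal.unique hf ▸ hs.hasSum

lemma sum_antidiagonal_assoc_swap {α : Type*} [AddCommMonoid α] (f : ℕ → ℕ → ℕ → α) (l : ℕ) :
    ∑ p ∈ antidiagonal l, ∑ q ∈ antidiagonal p.1, f q.1 q.2 p.2 =
      ∑ p ∈ antidiagonal l, ∑ q ∈ antidiagonal p.1, f q.1 p.2 q.2 := by
  rw [Finset.sum_sigma', Finset.sum_sigma']
  refine Finset.sum_nbij' (fun x => ⟨(x.2.1 + x.1.2, x.2.2), (x.2.1, x.1.2)⟩)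
    (fun x => ⟨(x.2.1 + x.1.2, x.2.2), (x.2.1, x.1.2)⟩) ?_ ?_ ?_ ?_ ?_
  all_goals
    rintro ⟨⟨a, b⟩, ⟨c, d⟩⟩ h
    simp only [Finset.mem_sigma, mem_antidiagonal] at h ⊢
  · exact ⟨by omega, trivial⟩
  · exact ⟨by omega, trivial⟩
  · obtain ⟨h1, rfl⟩ := h; rfl
  · obtain ⟨h1, rfl⟩ := h; rfl

end

/-- A "lurking contraction" extends to a contractive colligation. -/
lemma exists_contractive_colligation {X U F : Type*}
    [NormedAddCommGroup X] [InnerProductSpace ℂ X] [CompleteSpace X]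
    [NormedAddCommGroup U] [InnerProductSpace ℂ U] [CompleteSpace U]
    [NormedAddCommGroup F] [InnerProductSpace ℂ F] [CompleteSpace F]
    (Q R : X →L[ℂ] X) (E : X →L[ℂ] F) (N : X →L[ℂ] U)
    (h : ∀ x, ‖R x‖ ^ 2 + ‖N x‖ ^ 2 ≤ ‖Q x‖ ^ 2 + ‖E x‖ ^ 2) :
    ∃ (A : X →L[ℂ] X) (B : U →L[ℂ] X) (C : X →L[ℂ] F) (D : U →L[ℂ] F),
      (∀ y u, ‖A y + B u‖ ^ 2 + ‖C y + D u‖ ^ 2 ≤ ‖y‖ ^ 2 + ‖u‖ ^ 2) ∧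
      ∀ x y u, inner ℂ (Q x) (A y + B u) + inner ℂ (E x) (C y + D u) =
        inner ℂ (R x) y + inner ℂ (N x) u := by
  let eF := WithLp.prodContinuousLinearEquiv 2 ℂ X F
  let eU := WithLp.prodContinuousLinearEquiv 2 ℂ X U
  obtain ⟨W, hW, hWx⟩ := exists_contraction_comp_eq
    (eF.symm.toContinuousLinearMap ∘L Q.prod E) (eU.symm.toContinuousLinearMap ∘L R.prod N) (by
      intro x
      rw [← sq_le_sq₀ (norm_nonneg _) (norm_nonneg _), WithLp.prod_norm_sq_eq_of_L2,
        WithLp.prod_norm_sq_eq_of_L2]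
      exact h x)
  let V : X × U →L[ℂ] X × F :=
    eF.toContinuousLinearMap ∘L W.adjoint ∘L eU.symm.toContinuousLinearMap
  let V₁ := ContinuousLinearMap.fst ℂ X F ∘L V
  let V₂ := ContinuousLinearMap.snd ℂ X F ∘L V
  let i₁ := ContinuousLinearMap.inl ℂ X U
  let i₂ := ContinuousLinearMap.inr ℂ X U
  have h₁ : ∀ y u, (V₁ ∘L i₁) y + (V₁ ∘L i₂) u = (W.adjoint (eU.symm (y, u))).fst := by
    intro y u
    have : (y, u) = i₁ y + i₂ u := by simp [i₁, i₂]
    rw [this]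
    exact (map_add V₁ (i₁ y) (i₂ u)).symm
  have h₂ : ∀ y u, (V₂ ∘L i₁) y + (V₂ ∘L i₂) u = (W.adjoint (eU.symm (y, u))).snd := by
    intro y u
    have : (y, u) = i₁ y + i₂ u := by simp [i₁, i₂]
    rw [this]
    exact (map_add V₂ (i₁ y) (i₂ u)).symm
  refine ⟨V₁ ∘L i₁, V₁ ∘L i₂, V₂ ∘L i₁, V₂ ∘L i₂, fun y u => ?_, fun x y u => ?_⟩
  · rw [h₁, h₂, ← WithLp.prod_norm_sq_eq_of_L2]
    have : ‖eU.symm (y, u)‖ ^ 2 = ‖y‖ ^ 2 + ‖u‖ ^ 2 := WithLp.prod_norm_sq_eq_of_L2 _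
    rw [← this]
    gcongr
    refine (W.adjoint.le_opNorm _).trans (mul_le_of_le_one_left (norm_nonneg _) ?_)
    rwa [LinearIsometryEquiv.norm_map]
  · rw [h₁, h₂]
    have := ContinuousLinearMap.adjoint_inner_right W (eF.symm (Q x, E x)) (eU.symm (y, u))
    have h3 : W (eF.symm (Q x, E x)) = eU.symm (R x, N x) := hWx x
    rw [h3, WithLp.prod_inner_apply, WithLp.prod_inner_apply] at this
    exact this

section TransferFunction

variable {X U F : Type*}
  [NormedAddCommGroup X] [InnerProductSpace ℂ X]
  [NormedAddCommGroup U] [InnerProductSpace ℂ U]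
  [NormedAddCommGroup F] [InnerProductSpace ℂ F]

/-- Taylor coefficients of the transfer function `D + z C (1 - z A)⁻¹ B`. -/
def transferCoeff (A : X →L[ℂ] X) (B : U →L[ℂ] X) (C : X →L[ℂ] F) (D : U →L[ℂ] F) :
    ℕ → (U →L[ℂ] F)
  | 0 => D
  | k + 1 => C ∘L (A ^ k) ∘L B

lemma isContractiveMultiplier_transferCoeff
    (A : X →L[ℂ] X) (B : U →L[ℂ] X) (C : X →L[ℂ] F) (D : U →L[ℂ] F)
    (h : ∀ y u, ‖A y + B u‖ ^ 2 + ‖C y + D u‖ ^ 2 ≤ ‖y‖ ^ 2 + ‖u‖ ^ 2) :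
    IsContractiveMultiplier (fun _ => 1) (transferCoeff A B C D) := by
  intro g hg
  simp only [one_mul]
  let s : ℕ → X := fun k => ∑ j ∈ Finset.range k, (A ^ j) (B (g (k - 1 - j)))
  have hs : ∀ k, s (k + 1) = A (s k) + B (g k) := by
    intro k
    simp only [s, Finset.sum_range_succ', map_sum]
    congr 1
    refine Finset.sum_congr rfl fun j _ => ?_
    rw [pow_succ', mul_apply_eq_comp]
    congr 4
    omega
  have hy : ∀ k, ∑ j ∈ Finset.range (k + 1), transferCoeff A B C D j (g (k - j)) =
      C (s k) + D (g k) := by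
    intro k
    simp only [s, Finset.sum_range_succ', map_sum]
    congr 1
    refine Finset.sum_congr rfl fun j _ => ?_
    have : k - (j + 1) = k - 1 - j := by omega
    rw [this]
    rfl
  have henergy : ∀ n, ∑ k ∈ Finset.range n, ‖C (s k) + D (g k)‖ ^ 2 + ‖s n‖ ^ 2 ≤
      ∑ k ∈ Finset.range n, ‖g k‖ ^ 2 := by
    intro n
    induction n with
    | zero => simp [s]
    | succ n ih =>
      rw [Finset.sum_range_succ, Finset.sum_range_succ, hs]
      have := h (s n) (g n)
      linarith
  have hle : ∀ n, ∑ k ∈ Finset.range n, ‖C (s k) + D (g k)‖ ^ 2 ≤ ∑' k, ‖g k‖ ^ 2 := fun n =>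
    (le_add_of_nonneg_right (sq_nonneg _)).trans
      ((henergy n).trans (hg.sum_le_tsum _ fun _ _ => sq_nonneg _))
  simp only [hy]
  exact ⟨summable_of_sum_range_le (fun _ => sq_nonneg _) hle,
    Real.tsum_le_of_sum_range_le (fun _ => sq_nonneg _) hle⟩

lemma sum_inner_transferCoeff
    {A : X →L[ℂ] X} {B : U →L[ℂ] X} {C : X →L[ℂ] F} {D : U →L[ℂ] F}
    {T R : X →L[ℂ] X} {E : X →L[ℂ] F} {N : X →L[ℂ] U}
    (h : ∀ x y u, inner ℂ (R (T x)) (A y + B u) + inner ℂ (E x) (C y + D u) =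
        inner ℂ (R x) y + inner ℂ (N x) u) (x : X) (u : U) (n : ℕ) :
    ∑ k ∈ Finset.range (n + 1), inner ℂ (E ((T ^ k) x)) (transferCoeff A B C D k u) +
      inner ℂ (R ((T ^ (n + 1)) x)) ((A ^ n) (B u)) = inner ℂ (N x) u := by
  induction n with
  | zero =>
    have := h x 0 u
    simp only [map_zero, zero_add, inner_zero_right] at this
    simpa [transferCoeff, add_comm] using this
  | succ n ih =>
    have := h ((T ^ (n + 1)) x) ((A ^ n) (B u)) 0
    simp only [map_zero, add_zero, inner_zero_right] at this
    rw [← ih, Finset.sum_range_succ, ← this, pow_succ' T (n + 1), pow_succ' A n]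
    simp only [mul_apply_eq_comp, transferCoeff, ContinuousLinearMap.comp_apply]
    ring

end TransferFunction

/-- Tangential interpolation in the Schur class: positivity of the Pick operator gives a
contractive multiplier between unweighted Hardy spaces. -/
lemma exists_contractiveMultiplier_one {X U F : Type*}
    [NormedAddCommGroup X] [InnerProductSpace ℂ X] [CompleteSpace X]
    [NormedAddCommGroup U] [InnerProductSpace ℂ U] [CompleteSpace U]
    [NormedAddCommGroup F] [InnerProductSpace ℂ F] [CompleteSpace F]
    (T : X →L[ℂ] X) (E : X →L[ℂ] F) (N : X →L[ℂ] U)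
    (hE : OutputStable (fun _ => 1) E T) (hN : OutputStable (fun _ => 1) N T)
    (h : ∀ x : X, ∑' j, ‖N ((T ^ j) x)‖ ^ 2 ≤ ∑' j, ‖E ((T ^ j) x)‖ ^ 2) :
    ∃ D : ℕ → (U →L[ℂ] F), IsContractiveMultiplier (fun _ => 1) D ∧
      ∀ u x, Tendsto (fun n => ∑ k ∈ Finset.range n, inner ℂ (E ((T ^ k) x)) (D k u)) atTop
        (nhds (inner ℂ (N x) u)) := by
  obtain ⟨c, -, hc⟩ := hE
  obtain ⟨d, -, hd⟩ := hN
  simp only [inv_one, one_mul, forall_and] at hc hd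
  obtain ⟨OE, hOE⟩ := exists_clm_lp_two (fun j => E ∘L (T ^ j)) c hc.1 hc.2
  obtain ⟨ON, hON⟩ := exists_clm_lp_two (fun j => N ∘L (T ^ j)) d hd.1 hd.2
  have nE : ∀ x, ‖OE x‖ ^ 2 = ∑' j, ‖E ((T ^ j) x)‖ ^ 2 := fun x => by
    rw [← (lp_two_hasSum_norm_sq (OE x)).tsum_eq]
    simp [hOE]
  have nN : ∀ x, ‖ON x‖ ^ 2 = ∑' j, ‖N ((T ^ j) x)‖ ^ 2 := fun x => by
    rw [← (lp_two_hasSum_norm_sq (ON x)).tsum_eq]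
    simp [hON]
  obtain ⟨R, hR⟩ := exists_sqrt_sub OE ON fun x => by
    rw [← sq_le_sq₀ (norm_nonneg _) (norm_nonneg _), nE, nN]
    exact h x
  have hstein : ∀ x, ‖R x‖ ^ 2 + ‖N x‖ ^ 2 ≤ ‖(R ∘L T) x‖ ^ 2 + ‖E x‖ ^ 2 := fun x => by
    rw [ContinuousLinearMap.comp_apply, hR, hR, nE, nN, nE, nN, (hc.1 x).tsum_eq_zero_add,
      (hd.1 x).tsum_eq_zero_add]
    simp only [pow_succ, mul_apply_eq_comp, pow_zero, one_apply_eq_self]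
    apply le_of_eq
    ring
  obtain ⟨A, B, C, D, hcontr, hinner⟩ := exists_contractive_colligation (R ∘L T) R E N hstein
  refine ⟨transferCoeff A B C D, isContractiveMultiplier_transferCoeff A B C D hcontr,
    fun u x => ?_⟩
  have hAB : ∀ n, ‖(A ^ n) (B u)‖ ≤ ‖u‖ := by
    intro n
    induction n with
    | zero =>
      have := hcontr 0 u
      rw [← sq_le_sq₀ (norm_nonneg _) (norm_nonneg _)]
      simp at this ⊢
      nlinarith [sq_nonneg ‖D u‖]
    | succ n ih =>
      refine le_trans ?_ ih
      have := hcontr ((A ^ n) (B u)) 0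
      rw [← sq_le_sq₀ (norm_nonneg _) (norm_nonneg _), pow_succ' A, mul_apply_eq_comp]
      simp at this ⊢
      nlinarith [sq_nonneg ‖C ((A ^ n) (B u))‖]
  have hRT : Tendsto (fun n => ‖R ((T ^ n) x)‖) atTop (nhds 0) := by
    have h1 : Tendsto (fun n => ‖R ((T ^ n) x)‖ ^ 2) atTop (nhds 0) := by
      refine squeeze_zero (fun _ => sq_nonneg _) (fun n => ?_)
        (tendsto_sum_nat_add fun j => ‖E ((T ^ j) x)‖ ^ 2)
      rw [hR, nE]
      simp only [pow_add, mul_apply_eq_comp]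
      exact sub_le_self _ (sq_nonneg _)
    simpa [Real.sqrt_sq] using h1.sqrt
  rw [← tendsto_add_atTop_iff_nat 1]
  have hrem : Tendsto (fun n => inner ℂ (R ((T ^ (n + 1)) x)) ((A ^ n) (B u))) atTop
      (nhds 0) := by
    refine squeeze_zero_norm (a := fun n => ‖R ((T ^ (n + 1)) x)‖ * ‖u‖) (fun n => ?_) ?_
    · exact (norm_inner_le_norm _ _).trans (mul_le_mul_of_nonneg_left (hAB n) (norm_nonneg _))
    · simpa using ((tendsto_add_atTop_iff_nat 1).2 hRT).mul_const ‖u‖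
  have := (tendsto_const_nhds (x := inner ℂ (N x) u)).sub hrem
  rw [sub_zero] at this
  refine this.congr fun n => ?_
  rw [← sum_inner_transferCoeff hinner x u n, add_sub_cancel_right]

lemma hasSum_norm_sq_lp_prod {Y : Type*} [NormedAddCommGroup Y]
    (w : ℕ → lp (fun _ : ℕ => Y) 2)
    (hw : Summable fun m => ‖w m‖ ^ 2) :
    HasSum (fun p : ℕ × ℕ => ‖w p.1 p.2‖ ^ 2) (∑' m, ‖w m‖ ^ 2) := by
  have hs : Summable (fun p : ℕ × ℕ => ‖w p.1 p.2‖ ^ 2) := by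
    rw [summable_prod_of_nonneg fun _ => sq_nonneg _]
    refine ⟨fun m => (lp_two_hasSum_norm_sq (w m)).summable, ?_⟩
    simpa only [(lp_two_hasSum_norm_sq (w _)).tsum_eq] using hw
  have := hs.hasSum.prod_fiberwise fun m => lp_two_hasSum_norm_sq (w m)
  exact this.tsum_eq ▸ hs.hasSum

section Weighted

variable {U Y : Type*}
  [NormedAddCommGroup U] [InnerProductSpace ℂ U]
  [NormedAddCommGroup Y] [InnerProductSpace ℂ Y]

lemma IsContractiveMultiplier.apply_const {β : ℕ → ℝ} {S : ℕ → (U →L[ℂ] Y)}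
    (hS : IsContractiveMultiplier β S) (u : U) :
    Summable (fun l => β l * ‖S l u‖ ^ 2) ∧ ∑' l, β l * ‖S l u‖ ^ 2 ≤ ‖u‖ ^ 2 := by
  have h1 : HasSum (fun k => ‖(Pi.single 0 u : ℕ → U) k‖ ^ 2) (‖u‖ ^ 2) := by
    convert hasSum_ite_eq (0 : ℕ) (‖u‖ ^ 2) using 2 with k
    by_cases hk : k = 0 <;> simp [hk]
  have h2 : ∀ l, ∑ j ∈ Finset.range (l + 1), S j ((Pi.single 0 u : ℕ → U) (l - j)) = S l u := by
    intro l
    rw [Finset.sum_eq_single_of_mem l (by simp)]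
    · simp
    · intro j hj hjl
      have : l - j ≠ 0 := by have := Finset.mem_range.1 hj; omega
      simp [this]
  simpa only [h2, h1.tsum_eq] using hS _ h1.summable

lemma IsContractiveMultiplier.summable_pow_smul {β : ℕ → ℝ} (hβ : IsWeightSeq β)
    {S : ℕ → (U →L[ℂ] Y)} [CompleteSpace Y] (hS : IsContractiveMultiplier β S) {z : ℂ}
    (hz : z ∈ ball (0 : ℂ) 1) : Summable fun j => z ^ j • S j := by
  obtain ⟨hpos, -, hlim⟩ := hβ
  have hz1 : ‖z‖ < 1 := by simpa using hz
  obtain ⟨r, hzr, hr1⟩ := exists_between hz1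
  have hr0 : 0 < r := (norm_nonneg z).trans_lt hzr
  have hsr : 0 < √r := Real.sqrt_pos.2 hr0
  have hrr : r ≤ √r := Real.le_sqrt_of_sq_le (by nlinarith)
  have hev : ∀ᶠ j in atTop, r < β j ^ ((1 : ℝ) / j) :=
    eventually_lt_of_lt_liminf (hr1.trans_le hlim)
      (isBoundedUnder_of ⟨0, fun j => Real.rpow_nonneg (hpos j).le _⟩)
  have hq0 : 0 ≤ ‖z‖ / √r := by positivity
  have hq1 : ‖z‖ / √r < 1 := (div_lt_one hsr).2 (hzr.trans_le hrr)
  refine Summable.of_norm_bounded_eventually_nat (summable_geometric_of_lt_one hq0 hq1) ?_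
  filter_upwards [hev, eventually_ge_atTop 1] with j hj hj1
  have hj0 : (j : ℝ) ≠ 0 := by positivity
  have hβj : r ^ j ≤ β j := by
    calc r ^ j ≤ (β j ^ ((1 : ℝ) / j)) ^ j := by gcongr
      _ = β j := by
        rw [← Real.rpow_natCast, ← Real.rpow_mul (hpos j).le, one_div_mul_cancel hj0,
          Real.rpow_one]
  have hSj : ‖S j‖ ≤ (√r ^ j)⁻¹ := by
    refine ContinuousLinearMap.opNorm_le_bound _ (by positivity) fun u => ?_
    obtain ⟨hs, hle⟩ := hS.apply_const u
    have h1 : β j * ‖S j u‖ ^ 2 ≤ ‖u‖ ^ 2 :=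
      (hs.le_tsum j fun i _ => mul_nonneg (hpos i).le (sq_nonneg _)).trans hle
    have h2 : (√r ^ j * ‖S j u‖) ^ 2 ≤ ‖u‖ ^ 2 := by
      rw [mul_pow, ← pow_mul, mul_comm j 2, pow_mul, Real.sq_sqrt hr0.le]
      exact (mul_le_mul_of_nonneg_right hβj (sq_nonneg _)).trans h1
    rw [inv_mul_eq_div, le_div_iff₀' (by positivity)]
    exact (sq_le_sq₀ (by positivity) (norm_nonneg _)).1 h2
  rw [norm_smul, norm_pow, div_pow, div_eq_mul_inv]
  gcongr

/-- Increments of the reciprocals of the weights. -/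
def invIncrement (β : ℕ → ℝ) : ℕ → ℝ
  | 0 => 1
  | j + 1 => (β (j + 1))⁻¹ - (β j)⁻¹

lemma invIncrement_nonneg {β : ℕ → ℝ} (hpos : ∀ j, 0 < β j) (hmono : ∀ j, β (j + 1) ≤ β j) :
    ∀ j, 0 ≤ invIncrement β j
  | 0 => zero_le_one
  | j + 1 => sub_nonneg.2 (inv_anti₀ (hpos _) (hmono j))

lemma sum_invIncrement {β : ℕ → ℝ} (h0 : β 0 = 1) (l : ℕ) :
    ∑ j ∈ Finset.range (l + 1), invIncrement β j = (β l)⁻¹ := by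
  induction l with
  | zero => simp [invIncrement, h0]
  | succ l ih => rw [Finset.sum_range_succ, ih, invIncrement]; ring

open Finset.HasAntidiagonal

lemma sum_antidiagonal_snd {α : Type*} [AddCommMonoid α] (f : ℕ → α) (l : ℕ) :
    ∑ p ∈ antidiagonal l, f p.2 = ∑ j ∈ Finset.range (l + 1), f j := by
  rw [← Finset.Nat.sum_antidiagonal_swap]
  exact Finset.Nat.sum_antidiagonal_eq_sum_range_succ (fun i _ => f i) l

/-- Coefficients obtained by composing an `ℓ²(Y)`-valued power series with the row
`∑ √γ_j z^j`. -/
def rowCoeff (γ : ℕ → ℝ) (D : ℕ → (U →L[ℂ] lp (fun _ : ℕ => Y) 2)) (m : ℕ) : U →L[ℂ] Y :=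
  ∑ p ∈ antidiagonal m, ((√(γ p.2) : ℝ) : ℂ) • (lp.evalCLM ℂ (fun _ : ℕ => Y) 2 p.2 ∘L D p.1)

lemma rowCoeff_apply (γ : ℕ → ℝ) (D : ℕ → (U →L[ℂ] lp (fun _ : ℕ => Y) 2)) (m : ℕ) (u : U) :
    rowCoeff γ D m u = ∑ p ∈ antidiagonal m, ((√(γ p.2) : ℝ) : ℂ) • D p.1 u p.2 := by
  simp only [rowCoeff, sum_apply]
  rfl

lemma isContractiveMultiplier_rowCoeff {β γ : ℕ → ℝ} (hpos : ∀ j, 0 < β j) (hγ : ∀ j, 0 ≤ γ j)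
    (hβγ : ∀ l, ∑ j ∈ Finset.range (l + 1), γ j = (β l)⁻¹)
    {D : ℕ → (U →L[ℂ] lp (fun _ : ℕ => Y) 2)} (hD : IsContractiveMultiplier (fun _ => 1) D) :
    IsContractiveMultiplier β (rowCoeff γ D) := by
  intro h hh
  obtain ⟨hw, hwle⟩ := hD h hh
  simp only [one_mul] at hw hwle
  set w : ℕ → lp (fun _ : ℕ => Y) 2 := fun m => ∑ j ∈ Finset.range (m + 1), D j (h (m - j))
    with hwdef
  have hconv : ∀ l, ∑ j ∈ Finset.range (l + 1), rowCoeff γ D j (h (l - j)) =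
      ∑ p ∈ antidiagonal l, ((√(γ p.2) : ℝ) : ℂ) • w p.1 p.2 := by
    intro l
    rw [← Finset.Nat.sum_antidiagonal_eq_sum_range_succ (fun i k => rowCoeff γ D i (h k)) l]
    simp only [rowCoeff_apply]
    refine (sum_antidiagonal_assoc_swap
      (fun a b c => ((√(γ b) : ℝ) : ℂ) • D a (h c) b) l).trans ?_
    refine Finset.sum_congr rfl fun p _ => ?_
    rw [← Finset.smul_sum, hwdef]
    simp only
    rw [← Finset.Nat.sum_antidiagonal_eq_sum_range_succ (fun i k => D i (h k)) p.1]
    rw [lp.coeFn_sum, Finset.sum_apply]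
  have hb := (hasSum_norm_sq_lp_prod w hw).sum_antidiagonal
  have hle : ∀ l, β l * ‖∑ j ∈ Finset.range (l + 1), rowCoeff γ D j (h (l - j))‖ ^ 2 ≤
      ∑ p ∈ antidiagonal l, ‖w p.1 p.2‖ ^ 2 := by
    intro l
    rw [hconv]
    have h1 : ‖∑ p ∈ antidiagonal l, ((√(γ p.2) : ℝ) : ℂ) • w p.1 p.2‖ ≤
        ∑ p ∈ antidiagonal l, √(γ p.2) * ‖w p.1 p.2‖ := by
      refine (norm_sum_le _ _).trans (le_of_eq (Finset.sum_congr rfl fun p _ => ?_))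
      rw [norm_smul, Complex.norm_real, Real.norm_of_nonneg (Real.sqrt_nonneg _)]
    have h2 := Finset.sum_mul_sq_le_sq_mul_sq (antidiagonal l) (fun p => √(γ p.2))
      (fun p => ‖w p.1 p.2‖)
    have h3 : ∑ p ∈ antidiagonal l, √(γ p.2) ^ 2 = (β l)⁻¹ := by
      simp only [Real.sq_sqrt (hγ _)]
      rw [sum_antidiagonal_snd γ, hβγ]
    rw [h3] at h2
    calc _ ≤ β l * ((β l)⁻¹ * ∑ p ∈ antidiagonal l, ‖w p.1 p.2‖ ^ 2) := by
          have := (hpos l).le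
          gcongr
          exact (pow_le_pow_left₀ (norm_nonneg _) h1 2).trans h2
      _ = _ := mul_inv_cancel_left₀ (hpos l).ne' _
  have hs := Summable.of_nonneg_of_le
    (fun l => mul_nonneg (hpos l).le (sq_nonneg _)) hle hb.summable
  exact ⟨hs, (hs.tsum_le_tsum hle hb.summable).trans (hb.tsum_eq.trans_le hwle)⟩

end Weighted

open Finset.HasAntidiagonal in
lemma hasSum_inner_rowCoeff {X U Y : Type*}
    [NormedAddCommGroup X] [InnerProductSpace ℂ X]
    [NormedAddCommGroup U] [InnerProductSpace ℂ U]
    [NormedAddCommGroup Y] [InnerProductSpace ℂ Y]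
    {γ : ℕ → ℝ} {T : X →L[ℂ] X} {E : X →L[ℂ] Y} {E' : X →L[ℂ] lp (fun _ : ℕ => Y) 2}
    {D : ℕ → (U →L[ℂ] lp (fun _ : ℕ => Y) 2)}
    (hE' : ∀ x j, E' x j = ((√(γ j) : ℝ) : ℂ) • E ((T ^ j) x)) {x : X} {u : U} {a : ℂ}
    (hx : Summable fun n => ‖E' ((T ^ n) x)‖ ^ 2) (hu : Summable fun n => ‖D n u‖ ^ 2)
    (ha : Tendsto (fun n => ∑ k ∈ Finset.range n, inner ℂ (E' ((T ^ k) x)) (D k u)) atTop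
      (nhds a)) :
    HasSum (fun m => inner ℂ (E ((T ^ m) x)) (rowCoeff γ D m u)) a := by
  let f : ℕ × ℕ → ℂ := fun p => inner ℂ (E' ((T ^ p.1) x) p.2) (D p.1 u p.2)
  have hf : Summable f := by
    refine Summable.of_norm_bounded ((hasSum_norm_sq_lp_prod _ hx).summable.add
      (hasSum_norm_sq_lp_prod _ hu).summable) fun p => ?_
    refine (norm_inner_le_norm _ _).trans ?_
    nlinarith [sq_nonneg (‖E' ((T ^ p.1) x) p.2‖ - ‖D p.1 u p.2‖),
      sq_nonneg ‖E' ((T ^ p.1) x) p.2‖, sq_nonneg ‖D p.1 u p.2‖]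
  have h1 := hf.hasSum.prod_fiberwise fun n => lp.hasSum_inner (E' ((T ^ n) x)) (D n u)
  have h2 := tendsto_nhds_unique h1.tendsto_sum_nat ha
  have h3 := hf.hasSum.sum_antidiagonal
  rw [h2] at h3
  refine h3.of_forall_eq fun m => ?_
  rw [rowCoeff_apply, inner_sum]
  refine Finset.sum_congr rfl fun p hp => ?_
  obtain rfl := mem_antidiagonal.1 hp
  simp only [f]
  rw [hE', ← mul_apply_eq_comp, ← pow_add, add_comm p.2, inner_smul_left, inner_smul_right,
    Complex.conj_ofReal]

open Finset.HasAntidiagonal in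
lemma hasSum_norm_sq_of_increment {X Y : Type*}
    [NormedAddCommGroup X] [InnerProductSpace ℂ X]
    [NormedAddCommGroup Y] [InnerProductSpace ℂ Y]
    {β γ : ℕ → ℝ} (hγ : ∀ j, 0 ≤ γ j)
    (hβγ : ∀ l, ∑ j ∈ Finset.range (l + 1), γ j = (β l)⁻¹)
    {T : X →L[ℂ] X} {E : X →L[ℂ] Y} {E' : X →L[ℂ] lp (fun _ : ℕ => Y) 2}
    (hE' : ∀ x j, E' x j = ((√(γ j) : ℝ) : ℂ) • E ((T ^ j) x)) {x : X}
    (hx : Summable fun j => (β j)⁻¹ * ‖E ((T ^ j) x)‖ ^ 2) :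
    HasSum (fun n => ‖E' ((T ^ n) x)‖ ^ 2) (∑' j, (β j)⁻¹ * ‖E ((T ^ j) x)‖ ^ 2) := by
  have hterm : ∀ m, ∑ p ∈ antidiagonal m, ‖E' ((T ^ p.1) x) p.2‖ ^ 2 =
      (β m)⁻¹ * ‖E ((T ^ m) x)‖ ^ 2 := fun m => by
    rw [← hβγ, ← sum_antidiagonal_snd γ, Finset.sum_mul]
    refine Finset.sum_congr rfl fun p hp => ?_
    have hpm : p.2 + p.1 = m := (add_comm _ _).trans (mem_antidiagonal.1 hp)
    rw [hE', norm_smul, mul_pow, Complex.norm_real, Real.norm_of_nonneg (Real.sqrt_nonneg _),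
      Real.sq_sqrt (hγ _), ← mul_apply_eq_comp, ← pow_add, hpm]
  let f : ℕ × ℕ → ℝ := fun p => ‖E' ((T ^ p.1) x) p.2‖ ^ 2
  have h1 : HasSum f (∑' j, (β j)⁻¹ * ‖E ((T ^ j) x)‖ ^ 2) :=
    hasSum_of_hasSum_antidiagonal (fun _ => sq_nonneg _)
      (hx.hasSum.of_forall_eq hterm)
  exact h1.prod_fiberwise fun n => lp_two_hasSum_norm_sq (E' ((T ^ n) x))

lemma le_of_isContractiveMultiplier {X U Y : Type*}
    [NormedAddCommGroup X] [InnerProductSpace ℂ X]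
    [NormedAddCommGroup U] [InnerProductSpace ℂ U]
    [NormedAddCommGroup Y] [InnerProductSpace ℂ Y]
    {β : ℕ → ℝ} (hpos : ∀ j, 0 < β j) {T : X →L[ℂ] X} {E : X →L[ℂ] Y} {N : X →L[ℂ] U}
    {S : ℕ → (U →L[ℂ] Y)} (hS : IsContractiveMultiplier β S)
    (hi : ∀ u x, HasSum (fun j => inner ℂ (E ((T ^ j) x)) (S j u)) (inner ℂ (N x) u)) {x : X}
    (hx : Summable fun j => (β j)⁻¹ * ‖E ((T ^ j) x)‖ ^ 2) :
    ∑' j, ‖N ((T ^ j) x)‖ ^ 2 ≤ ∑' j, (β j)⁻¹ * ‖E ((T ^ j) x)‖ ^ 2 := by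
  refine Real.tsum_le_of_sum_range_le (fun _ => sq_nonneg _) fun n => ?_
  let h : ℕ → U := fun k => if k < n then N ((T ^ k) x) else 0
  have hh0 : ∀ k, n ≤ k → h k = 0 := fun k hk => if_neg hk.not_gt
  have hhn : ∀ k ∈ Finset.range n, h k = N ((T ^ k) x) := fun k hk =>
    if_pos (Finset.mem_range.1 hk)
  have hsum : HasSum (fun k => ‖h k‖ ^ 2) (∑ k ∈ Finset.range n, ‖N ((T ^ k) x)‖ ^ 2) := by
    rw [Finset.sum_congr rfl fun k hk => show ‖N ((T ^ k) x)‖ ^ 2 = ‖h k‖ ^ 2 by rw [hhn k hk]]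
    refine hasSum_sum_of_ne_finset_zero fun k hk => ?_
    rw [hh0 k (by simpa using hk), norm_zero, zero_pow two_ne_zero]
  obtain ⟨hg, hgle⟩ := hS h hsum.summable
  rw [hsum.tsum_eq] at hgle
  have hshift : ∀ k, HasSum
      (fun l => if k ≤ l then inner ℂ (E ((T ^ l) x)) (S (l - k) (h k)) else 0)
      (inner ℂ (N ((T ^ k) x)) (h k)) := by
    intro k
    have h1 := hi (h k) ((T ^ k) x)
    rw [← hasSum_nat_add_iff' k, Finset.sum_eq_zero (fun i hi => if_neg
      (Finset.mem_range.1 hi).not_ge), sub_zero]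
    refine h1.of_forall_eq fun j => ?_
    rw [if_pos (Nat.le_add_left k j), Nat.add_sub_cancel, pow_add, mul_apply_eq_comp]
  have hall := hasSum_sum (s := Finset.range n) fun k _ => hshift k
  have hterm : ∀ l, ∑ k ∈ Finset.range n,
      (if k ≤ l then inner ℂ (E ((T ^ l) x)) (S (l - k) (h k)) else 0) =
      inner ℂ (E ((T ^ l) x)) (∑ j ∈ Finset.range (l + 1), S j (h (l - j))) := by
    intro l
    rw [← Finset.Nat.sum_antidiagonal_eq_sum_range_succ (fun i k => S i (h k)) l,
      ← Finset.Nat.sum_antidiagonal_swap]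
    simp only [Prod.fst_swap, Prod.snd_swap]
    rw [Finset.Nat.sum_antidiagonal_eq_sum_range_succ (fun k i => S i (h k)) l, inner_sum,
      ← Finset.sum_filter]
    refine Finset.sum_subset (fun k hk => ?_) fun k hk hk' => ?_
    · simp only [Finset.mem_filter, Finset.mem_range] at hk ⊢
      omega
    · simp only [Finset.mem_filter, Finset.mem_range] at hk hk'
      rw [hh0 k (by omega), map_zero, inner_zero_right]
  have hval : ∑ k ∈ Finset.range n, inner ℂ (N ((T ^ k) x)) (h k) =
      ((∑ k ∈ Finset.range n, ‖N ((T ^ k) x)‖ ^ 2 : ℝ) : ℂ) := by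
    rw [Complex.ofReal_sum]
    refine Finset.sum_congr rfl fun k hk => ?_
    rw [hhn k hk, inner_self_eq_norm_sq_to_K]
    simp
  simp only [hterm] at hall
  rw [hval] at hall
  have hre := Complex.hasSum_re hall
  rw [Complex.ofReal_re] at hre
  have hbound := hasSum_le (fun l => ?_) hre ((hx.hasSum.add hg.hasSum).mul_left (1 / 2))
  · linarith
  · set g := ∑ j ∈ Finset.range (l + 1), S j (h (l - j))
    refine (Complex.re_le_norm _).trans ((norm_inner_le_norm _ _).trans ?_)
    have hb := hpos l
    have key : 0 ≤ (β l)⁻¹ * (‖E ((T ^ l) x)‖ - β l * ‖g‖) ^ 2 := by positivity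
    have : (β l)⁻¹ * (‖E ((T ^ l) x)‖ - β l * ‖g‖) ^ 2 = (β l)⁻¹ * ‖E ((T ^ l) x)‖ ^ 2 +
        β l * ‖g‖ ^ 2 - 2 * (‖E ((T ^ l) x)‖ * ‖g‖) := by
      field_simp
      ring
    linarith

theorem stmt8 {X U Y : Type*}
    [NormedAddCommGroup X] [InnerProductSpace ℂ X] [CompleteSpace X]
    [NormedAddCommGroup U] [InnerProductSpace ℂ U] [CompleteSpace U]
    [NormedAddCommGroup Y] [InnerProductSpace ℂ Y] [CompleteSpace Y]
    (β : ℕ → ℝ) (hβ : IsWeightSeq β) (hmono : ∀ j, β (j + 1) ≤ β j)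
    (T : X →L[ℂ] X) (E : X →L[ℂ] Y) (N : X →L[ℂ] U)
    (hET : OutputStable β E T) (hNT : OutputStable (fun _ => 1) N T) :
    -- existence of a contractive-multiplier solution of the interpolation problem ...
    (∃ (S : ℂ → (U →L[ℂ] Y)) (Sc : ℕ → (U →L[ℂ] Y)),
      (∀ z ∈ ball (0 : ℂ) 1, HasSum (fun j => z ^ j • Sc j) (S z)) ∧
      IsContractiveMultiplier β Sc ∧
      ∀ (u : U) (x : X),
        HasSum (fun j => inner (𝕜 := ℂ) (E ((T ^ j) x)) (Sc j u))
          (inner (𝕜 := ℂ) (N x) u)) ↔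
    -- ... iff the Pick operator `P = G_{β,E,T} - G_{1,N,T}` is positive semidefinite
    (∀ x : X, ∑' j, ‖N ((T ^ j) x)‖ ^ 2 ≤ ∑' j, (β j)⁻¹ * ‖E ((T ^ j) x)‖ ^ 2) := by
  obtain ⟨hpos, h0, hlim⟩ := id hβ
  obtain ⟨c, -, hc⟩ := hET
  refine ⟨fun ⟨_, Sc, _, hS, hi⟩ x => le_of_isContractiveMultiplier hpos hS hi (hc x).1,
    fun h => ?_⟩
  have hγ := invIncrement_nonneg hpos hmono
  have hβγ := sum_invIncrement h0
  have hγle : ∀ j, invIncrement β j ≤ (β j)⁻¹ := fun j => by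
    rw [← hβγ]
    exact Finset.single_le_sum (fun i _ => hγ i) (Finset.self_mem_range_succ j)
  have hnorm : ∀ x j, ‖(((√(invIncrement β j) : ℝ) : ℂ) • (E ∘L (T ^ j))) x‖ ^ 2 =
      invIncrement β j * ‖E ((T ^ j) x)‖ ^ 2 := fun x j => by
    rw [smul_apply, norm_smul, mul_pow, Complex.norm_real,
      Real.norm_of_nonneg (Real.sqrt_nonneg _), Real.sq_sqrt (hγ j)]
    rfl
  have hle : ∀ x j, invIncrement β j * ‖E ((T ^ j) x)‖ ^ 2 ≤
      (β j)⁻¹ * ‖E ((T ^ j) x)‖ ^ 2 := fun x j =>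
    mul_le_mul_of_nonneg_right (hγle j) (sq_nonneg _)
  have hsum : ∀ x, Summable fun j => invIncrement β j * ‖E ((T ^ j) x)‖ ^ 2 := fun x =>
    Summable.of_nonneg_of_le (fun j => mul_nonneg (hγ j) (sq_nonneg _)) (hle x) (hc x).1
  obtain ⟨E', hE'⟩ := exists_clm_lp_two
    (fun j => ((√(invIncrement β j) : ℝ) : ℂ) • (E ∘L (T ^ j))) c
    (fun x => by simpa only [hnorm] using hsum x)
    (fun x => by
      simp only [hnorm]
      exact ((hsum x).tsum_le_tsum (hle x) (hc x).1).trans (hc x).2)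
  replace hE' : ∀ x j, E' x j = ((√(invIncrement β j) : ℝ) : ℂ) • E ((T ^ j) x) := hE'
  have hE's := fun x => hasSum_norm_sq_of_increment hγ hβγ hE' (hc x).1
  obtain ⟨D, hD, hDi⟩ := exists_contractiveMultiplier_one T E' N
    ⟨max c 0, le_max_right _ _, fun x => by
      simp only [inv_one, one_mul]
      refine ⟨(hE's x).summable, (hE's x).tsum_eq.trans_le ((hc x).2.trans ?_)⟩
      exact mul_le_mul_of_nonneg_right (le_max_left _ _) (sq_nonneg _)⟩
    hNT (fun x => (h x).trans_eq (hE's x).tsum_eq.symm)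
  have hS := isContractiveMultiplier_rowCoeff hpos hγ hβγ hD
  refine ⟨fun z => ∑' j, z ^ j • rowCoeff (invIncrement β) D j, rowCoeff (invIncrement β) D,
    fun z hz => (hS.summable_pow_smul hβ hz).hasSum, hS, fun u x => ?_⟩
  exact hasSum_inner_rowCoeff hE' (hE's x).summable
    (by simpa only [one_mul] using (hD.apply_const u).1) (hDi u x)
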